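/- For every m ∈ ℕ there exists N ∈ ℕ such that for all a_1, a_2, a_3, a_4 ≥ N, dim_k (R/M_4)_{mℓ + a_1ε_1 + a_2ε_2 + a_3ε_3 + a_4ε_4} = (m+2 choose 2). -/

import Mathlib

open MvPolynomial

/- The polynomial ring `R = k[e₁,e₂,e₃,e₄,f₁₂,f₁₃,f₁₄,f₂₃,f₂₄,f₃₄]` is modelled as
`MvPolynomial (Fin 10) k`, with `e₁ = X 0, e₂ = X 1, e₃ = X 2, e₄ = X 3`,
`f₁₂ = X 4, f₁₃ = X 5, f₁₄ = X 6, f₂₃ = X 7, f₂₄ = X 8, f₃₄ = X 9`.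
The grading group is `ℤ⁵` with basis `ℓ, ε₁, ε₂, ε₃, ε₄` (coordinate 0 is the
`ℓ`-coordinate); `deg eᵢ = εᵢ`, `deg fᵢⱼ = ℓ − εᵢ − εⱼ`. -/
def deg4 : Fin 10 → Fin 5 → ℤ :=
  ![![0,1,0,0,0], ![0,0,1,0,0], ![0,0,0,1,0], ![0,0,0,0,1],
    ![1,-1,-1,0,0], ![1,-1,0,-1,0], ![1,-1,0,0,-1],
    ![1,0,-1,-1,0], ![1,0,-1,0,-1], ![1,0,0,-1,-1]]

/-- The ideal `Q₄` generated by the five quadric relations among the distinguished sections of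
the conic bundles on the degree-5 Del Pezzo surface. -/
noncomputable def Q4 (k : Type*) [Field k] : Ideal (MvPolynomial (Fin 10) k) :=
  Ideal.span
    {X 6 * X 7 - X 4 * X 9 - X 5 * X 8,
     X 1 * X 4 - X 2 * X 5 - X 3 * X 6,
     X 0 * X 4 - X 2 * X 7 - X 3 * X 8,
     X 0 * X 5 - X 1 * X 7 + X 3 * X 9,
     X 0 * X 6 - X 1 * X 8 - X 2 * X 9}

/-- The monomial ideal `M₄ = (f₂₃f₁₄, e₁f₁₄, e₁f₁₃, e₂f₁₂, e₁f₁₂)`. -/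
noncomputable def M4 (k : Type*) [Field k] : Ideal (MvPolynomial (Fin 10) k) :=
  Ideal.span {X 7 * X 6, X 0 * X 6, X 0 * X 5, X 1 * X 4, X 0 * X 4}

/-- The `P`-degree of a monomial for the grading `deg`. -/
def mdeg {n : ℕ} {P : Type*} [AddCommMonoid P] (deg : Fin n → P) (a : Fin n →₀ ℕ) : P :=
  a.sum fun i e => e • deg i

/-- The `k`-span of the monomials of degree `D`. -/
noncomputable def degSub {k : Type*} [Field k] {n : ℕ} {P : Type*} [AddCommMonoid P]
    (deg : Fin n → P) (D : P) : Submodule k (MvPolynomial (Fin n) k) :=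
  Submodule.span k
    ((fun a => (monomial a (1 : k) : MvPolynomial (Fin n) k)) '' { a | mdeg deg a = D })

/-- The degree-`D` piece `(R/Q)_D` of the quotient. -/
noncomputable def quotPiece {k : Type*} [Field k] {n : ℕ} {P : Type*} [AddCommMonoid P]
    (Q : Ideal (MvPolynomial (Fin n) k)) (deg : Fin n → P) (D : P) :
    Submodule k (MvPolynomial (Fin n) k ⧸ Submodule.restrictScalars k Q) :=
  Submodule.map (Submodule.restrictScalars k Q).mkQ (degSub deg D)

/-- The degree `mℓ + a₁ε₁ + a₂ε₂ + a₃ε₃ + a₄ε₄`. -/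
def Dv4 (m : ℕ) (a : Fin 4 → ℕ) : Fin 5 → ℤ :=
  ![(m : ℤ), (a 0 : ℤ), (a 1 : ℤ), (a 2 : ℤ), (a 3 : ℤ)]

/-- The degree-`D` piece of the quotient by a monomial ideal has as dimension the number of
standard monomials of degree `D`. -/
theorem finrank_quotPiece_span_monomial {k : Type*} [Field k] {n : ℕ} {P : Type*}
    [AddCommMonoid P] (s : Set (Fin n →₀ ℕ)) (deg : Fin n → P) (D : P) :
    Module.finrank k (quotPiece (Ideal.span ((fun b => monomial b (1 : k)) '' s)) deg D) =
      Nat.card {b : Fin n →₀ ℕ // mdeg deg b = D ∧ ∀ c ∈ s, ¬ c ≤ b} := by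
  set Q := Ideal.span ((fun b => monomial b (1 : k)) '' s) with hQ
  set T : Set (Fin n →₀ ℕ) := {b | mdeg deg b = D ∧ ∀ c ∈ s, ¬ c ≤ b} with hT
  set q := (Submodule.restrictScalars k Q).mkQ with hq
  have hrange : Set.range (fun b : T => monomial (b : Fin n →₀ ℕ) (1 : k)) =
      (fun b => monomial b (1 : k)) '' T := by
    rw [Set.image_eq_range]
  have hli : LinearIndependent k (fun b : T => monomial (b : Fin n →₀ ℕ) (1 : k)) := by
    have h := (basisMonomials (Fin n) k).linearIndependent
    rw [coe_basisMonomials] at h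
    exact h.comp _ Subtype.val_injective
  have hdisj : Disjoint (Submodule.span k
      (Set.range (fun b : T => monomial (b : Fin n →₀ ℕ) (1 : k)))) (LinearMap.ker q) := by
    rw [hrange, hq, Submodule.ker_mkQ, Submodule.disjoint_def]
    intro x hx hxQ
    rw [← restrictSupport_eq_span, mem_restrictSupport_iff] at hx
    rw [Submodule.restrictScalars_mem, hQ, mem_ideal_span_monomial_image] at hxQ
    rw [← support_eq_empty, Finset.eq_empty_iff_forall_notMem]
    intro b hb
    obtain ⟨c, hc, hcb⟩ := hxQ b hb
    exact (hx hb).2 c hc hcb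
  have hspan : quotPiece Q deg D =
      Submodule.span k (Set.range (q ∘ fun b : T => monomial (b : Fin n →₀ ℕ) (1 : k))) := by
    rw [quotPiece, degSub, Submodule.map_span]
    apply le_antisymm
    · rw [Submodule.span_le]
      rintro _ ⟨_, ⟨b, hb, rfl⟩, rfl⟩
      by_cases hbs : ∃ c ∈ s, c ≤ b
      · have hbQ : monomial b (1 : k) ∈ Q := by
          rw [hQ, mem_ideal_span_monomial_image]
          intro c hc
          rwa [Finset.mem_singleton.mp (support_monomial_subset hc)]
        have h0 : q (monomial b (1 : k)) = 0 := by
          rw [hq, Submodule.mkQ_apply, Submodule.Quotient.mk_eq_zero]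
          exact hbQ
        simp only [SetLike.mem_coe]
        rw [h0]
        exact zero_mem _
      · push Not at hbs
        exact Submodule.subset_span ⟨⟨b, hb, hbs⟩, rfl⟩
    · apply Submodule.span_mono
      rintro _ ⟨b, rfl⟩
      exact ⟨_, ⟨b, b.2.1, rfl⟩, rfl⟩
  rw [hspan]
  exact Module.finrank_eq_nat_card_basis (Module.Basis.span (hli.map hdisj))

/-- The exponents of the monomial generators of `M₄`. -/
abbrev M4Exponents : Set (Fin 10 →₀ ℕ) :=
  {.single 7 1 + .single 6 1, .single 0 1 + .single 6 1, .single 0 1 + .single 5 1,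
    .single 1 1 + .single 4 1, .single 0 1 + .single 4 1}

theorem M4_eq_span_monomial (k : Type*) [Field k] :
    M4 k = Ideal.span ((fun b => monomial b (1 : k)) '' M4Exponents) := by
  simp [M4, Set.image_insert_eq, X, monomial_mul]

/-- A product of two distinct variables divides a monomial exactly when both occur in it. -/
theorem single_add_single_le_iff {n : ℕ} {i j : Fin n} (hij : i ≠ j) (b : Fin n →₀ ℕ) :
    Finsupp.single i 1 + Finsupp.single j 1 ≤ b ↔ b i ≠ 0 ∧ b j ≠ 0 := by
  constructor
  · intro h
    have hi := h i
    have hj := h j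
    simp [hij, hij.symm] at hi hj
    omega
  · rintro ⟨hi, hj⟩ l
    simp only [Finsupp.add_apply, Finsupp.single_apply]
    grind

theorem mdeg_deg4_eq_Dv4_iff (m : ℕ) (a : Fin 4 → ℕ) (b : Fin 10 →₀ ℕ) :
    mdeg deg4 b = Dv4 m a ↔
      b 4 + b 5 + b 6 + b 7 + b 8 + b 9 = m ∧
      b 0 = a 0 + b 4 + b 5 + b 6 ∧ b 1 = a 1 + b 4 + b 7 + b 8 ∧
      b 2 = a 2 + b 5 + b 7 + b 9 ∧ b 3 = a 3 + b 6 + b 8 + b 9 := by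
  rw [mdeg, Finsupp.sum_fintype _ _ (by simp), funext_iff]
  simp [Fin.forall_fin_succ, Fin.sum_univ_succ, deg4, Dv4]
  omega

/-- In degrees with all `aᵢ > 0`, the standard monomials of `M₄` are determined by their exponents
at `f₂₃, f₂₄, f₃₄`, which are arbitrary with sum `m`. -/
noncomputable def standardMonomialEquiv (m : ℕ) (a : Fin 4 → ℕ) (ha : ∀ i, 1 ≤ a i) :
    {b : Fin 10 →₀ ℕ // mdeg deg4 b = Dv4 m a ∧ ∀ c ∈ M4Exponents, ¬ c ≤ b} ≃
      Finset.finsuppAntidiag (Finset.univ : Finset (Fin 3)) m :=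
  have h0 := ha 0
  have h1 := ha 1
  have vanish {b : Fin 10 →₀ ℕ} (hb : mdeg deg4 b = Dv4 m a ∧
      ∀ c ∈ M4Exponents, ¬ c ≤ b) :
      b 4 = 0 ∧ b 5 = 0 ∧ b 6 = 0 := by
    simp only [mdeg_deg4_eq_Dv4_iff, Set.forall_mem_insert, Set.mem_singleton_iff, forall_eq] at hb
    obtain ⟨hd, -, h06, h05, -, h04⟩ := hb
    rw [single_add_single_le_iff (by decide)] at h06 h05 h04
    omega
  { toFun b := ⟨Finsupp.equivFunOnFinite.symm ![b.1 7, b.1 8, b.1 9], by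
      have hv := vanish b.2
      have hd := (mdeg_deg4_eq_Dv4_iff m a b.1).mp b.2.1
      simp [Finset.mem_finsuppAntidiag, Fin.sum_univ_succ]
      omega⟩
    invFun c := ⟨Finsupp.equivFunOnFinite.symm
        ![a 0, a 1 + c.1 0 + c.1 1, a 2 + c.1 0 + c.1 2, a 3 + c.1 1 + c.1 2,
          0, 0, 0, c.1 0, c.1 1, c.1 2], by
      have hc := (Finset.mem_finsuppAntidiag.mp c.2).1
      rw [Fin.sum_univ_three] at hc
      constructor
      · rw [mdeg_deg4_eq_Dv4_iff]
        simp
        omega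
      · simp only [Set.forall_mem_insert, Set.mem_singleton_iff, forall_eq]
        refine ⟨?_, ?_, ?_, ?_, ?_⟩ <;> rw [single_add_single_le_iff (by decide)] <;> simp⟩
    left_inv b := by
      have hv := vanish b.2
      have hd := (mdeg_deg4_eq_Dv4_iff m a b.1).mp b.2.1
      ext i
      fin_cases i <;> simp <;> omega
    right_inv c := by
      ext i
      fin_cases i <;> simp }

/-- For every `m` and all `a₁,…,a₄ ≫ 0`,
`dim_k (R/M₄)_{mℓ+a₁ε₁+⋯+a₄ε₄} = (m+2 choose 2)`. -/
theorem stmt10 {k : Type*} [Field k] (m : ℕ) :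
    ∃ N : ℕ, ∀ a : Fin 4 → ℕ, (∀ i, N ≤ a i) →
      Module.finrank k (quotPiece (M4 k) deg4 (Dv4 m a)) = Nat.choose (m + 2) 2 := by
  refine ⟨1, fun a ha => ?_⟩
  rw [M4_eq_span_monomial, finrank_quotPiece_span_monomial,
    Nat.card_congr (standardMonomialEquiv m a ha), Nat.card_eq_fintype_card, Fintype.card_coe,
    Finset.card_finsuppAntidiag_nat_eq_choose, Finset.card_univ, Fintype.card_fin,
    Nat.choose_symm_of_eq_add (by omega : 3 + m - 1 = m + 2)]
  congr 1
  omega
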